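/- Let d ≥ 1 and β ≥ 1 be integers and L > 0. If f ∈ S_L^p(β), then Σ_{k∈ℤ^d} ( Σ_{α∈ℕ^d, |α|=β} Π_{i=1}^d (2π k_i)^{2α_i} ) · |θ_k(f)|² ≤ L², where θ_k(f) is the k-th Fourier coefficient of f. -/

import Mathlib

open MeasureTheory ProbabilityTheory Real Complex Finset

noncomputable section

def cube (d : ℕ) : Set (Fin d → ℝ) := Set.Icc 0 1

def phi (d : ℕ) (k : Fin d → ℤ) (x : Fin d → ℝ) : ℂ :=
  Complex.exp (Complex.I * (2 * Real.pi) * ∑ i, (k i : ℂ) * (x i : ℂ))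

def fCoeff (d : ℕ) (g : (Fin d → ℝ) → ℂ) (k : Fin d → ℤ) : ℂ :=
  ∫ x in cube d, g x * (starRingEnd ℂ) (phi d k x)

/-- Partial derivative in the `i`-th coordinate direction. -/
def pderiv (d : ℕ) (i : Fin d) (g : (Fin d → ℝ) → ℝ) : (Fin d → ℝ) → ℝ :=
  fun x => deriv (fun t => g (Function.update x i t)) (x i)

/-- Iterated partial derivative `∂^α g` for the multi-index `α`. -/
def mderiv (d : ℕ) (α : Fin d → ℕ) (g : (Fin d → ℝ) → ℝ) : (Fin d → ℝ) → ℝ :=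
  (List.finRange d).foldr (fun i h => (pderiv d i)^[α i] h) g

/-- The finite set of multi-indices `α ∈ ℕ^d` with `|α| = β`. -/
def multiIdx (d β : ℕ) : Finset (Fin d → ℕ) :=
  (Fintype.piFinset fun _ : Fin d => Finset.range (β + 1)).filter fun α => ∑ i, α i = β

/-- The periodic Sobolev ball `S_L^p(β)` of integer smoothness `β`: `f` is `β` times
continuously differentiable, the total energy of the `β`-th derivatives is at most `L²`,
and all derivatives of order `< β` (including `f` itself) satisfy the periodic boundary
condition on `[0,1]^d`. -/
def SobolevP (d β : ℕ) (L : ℝ) (f : (Fin d → ℝ) → ℝ) : Prop :=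
  ContDiff ℝ (β : ℕ∞) f ∧
  (∑ α ∈ multiIdx d β, ∫ x in cube d, (mderiv d α f x) ^ 2) ≤ L ^ 2 ∧
  ∀ α : Fin d → ℕ, (∑ i, α i) < β →
    ∀ x ∈ cube d, ∀ i : Fin d, (x i = 0 ∨ x i = 1) →
      mderiv d α f x = mderiv d α f (Function.update x i (1 - x i))

theorem continuous_phi (d : ℕ) (k : Fin d → ℤ) : Continuous (phi d k) := by
  unfold phi
  fun_prop

theorem conj_phi (d : ℕ) (k : Fin d → ℤ) (x : Fin d → ℝ) :
    (starRingEnd ℂ) (phi d k x) = phi d (-k) x := by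
  simp only [phi, ← Complex.exp_conj, map_mul, map_sum, Complex.conj_I, Complex.conj_ofReal,
    map_ofNat, map_intCast, Pi.neg_apply, Int.cast_neg, neg_mul, Finset.sum_neg_distrib, mul_neg]

theorem phi_mul_phi (d : ℕ) (k l : Fin d → ℤ) (x : Fin d → ℝ) :
    phi d k x * phi d l x = phi d (k + l) x := by
  simp only [phi, ← Complex.exp_add, Pi.add_apply, Int.cast_add, add_mul, Finset.sum_add_distrib,
    mul_add]

theorem contDiff_phi (d : ℕ) (k : Fin d → ℤ) {n : WithTop ℕ∞} : ContDiff ℝ n (phi d k) := by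
  unfold phi
  refine Complex.contDiff_exp.comp (contDiff_const.mul (ContDiff.sum fun i _ => ?_))
  exact contDiff_const.mul (Complex.ofRealCLM.contDiff.comp (contDiff_apply ℝ ℝ i))

theorem integral_exp_two_pi_int (m : ℤ) :
    ∫ t in Set.Icc (0 : ℝ) 1, Complex.exp (Complex.I * (2 * Real.pi) * (m * (t : ℂ))) =
      if m = 0 then 1 else 0 := by
  rw [integral_Icc_eq_integral_Ioc, ← intervalIntegral.integral_of_le zero_le_one]
  split_ifs with h
  · simp [h]
  · have hc : Complex.I * (2 * Real.pi) * (m : ℂ) ≠ 0 := by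
      simp [h, Real.pi_ne_zero]
    simp only [← mul_assoc (Complex.I * (2 * Real.pi))]
    rw [integral_exp_mul_complex hc]
    have : Complex.exp (Complex.I * (2 * Real.pi) * (m : ℂ)) = 1 := by
      rw [← Complex.exp_int_mul_two_pi_mul_I m]
      congr 1
      ring
    simp [this]

theorem integral_phi (d : ℕ) (k : Fin d → ℤ) :
    ∫ x in cube d, phi d k x = if k = 0 then 1 else 0 := by
  have hcube : cube d = Set.univ.pi fun _ => Set.Icc (0 : ℝ) 1 := by
    rw [Set.pi_univ_Icc]; rfl
  have hphi : ∀ x : Fin d → ℝ, phi d k x =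
      ∏ i, Complex.exp (Complex.I * (2 * Real.pi) * (k i * (x i : ℂ))) := by
    intro x
    rw [phi, Finset.mul_sum, Complex.exp_sum]
  simp_rw [hphi]
  rw [hcube, volume_pi, Measure.restrict_pi_pi,
    integral_fintype_prod_eq_prod
      (fun i (t : ℝ) => Complex.exp (Complex.I * (2 * Real.pi) * (k i * (t : ℂ))))]
  simp_rw [integral_exp_two_pi_int]
  split_ifs with h
  · simp [h]
  · obtain ⟨i, hi⟩ := Function.ne_iff.mp h
    exact Finset.prod_eq_zero (Finset.mem_univ i) (by simpa using hi)

theorem memLp_two_cube {d : ℕ} {g : (Fin d → ℝ) → ℂ} (hg : Continuous g) :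
    MemLp g 2 (volume.restrict (cube d)) := by
  have hc : IsCompact (cube d) := isCompact_Icc
  have : IsFiniteMeasure (volume.restrict (cube d)) := ⟨by
    simpa using hc.measure_lt_top⟩
  obtain ⟨C, hC⟩ := hc.exists_bound_of_continuousOn hg.continuousOn
  exact MemLp.of_bound hg.aestronglyMeasurable C
    ((ae_restrict_iff' hc.measurableSet).mpr (Filter.Eventually.of_forall hC))

theorem inner_toLp_two {d : ℕ} {g h : (Fin d → ℝ) → ℂ}
    (hg : MemLp g 2 (volume.restrict (cube d))) (hh : MemLp h 2 (volume.restrict (cube d))) :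
    inner ℂ (hg.toLp g) (hh.toLp h) = ∫ x in cube d, h x * (starRingEnd ℂ) (g x) := by
  rw [L2.inner_def]
  refine integral_congr_ae ?_
  filter_upwards [hg.coeFn_toLp, hh.coeFn_toLp] with x hx hy
  rw [hx, hy]
  exact RCLike.inner_apply _ _

theorem orthonormal_phi (d : ℕ) :
    Orthonormal ℂ fun k : Fin d → ℤ => (memLp_two_cube (continuous_phi d k)).toLp (phi d k) := by
  rw [orthonormal_iff_ite]
  intro k l
  rw [inner_toLp_two]
  simp_rw [conj_phi, phi_mul_phi]
  rw [integral_phi]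
  simp only [← sub_eq_add_neg, sub_eq_zero, eq_comm]

/-- Bessel's inequality for the trigonometric system on the unit cube. -/
theorem sum_sq_fCoeff_le {d : ℕ} {g : (Fin d → ℝ) → ℝ} (hg : Continuous g)
    (s : Finset (Fin d → ℤ)) :
    ∑ k ∈ s, ‖fCoeff d (fun x => (g x : ℂ)) k‖ ^ 2 ≤ ∫ x in cube d, g x ^ 2 := by
  have hm : MemLp (fun x => (g x : ℂ)) 2 (volume.restrict (cube d)) :=
    memLp_two_cube (Complex.continuous_ofReal.comp hg)
  have h := (orthonormal_phi d).sum_inner_products_le (s := s) (hm.toLp _)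
  simp_rw [inner_toLp_two] at h
  refine h.trans_eq ?_
  rw [← Complex.ofReal_inj, ← integral_complex_ofReal]
  push_cast
  refine (inner_self_eq_norm_sq_to_K (𝕜 := ℂ) (hm.toLp _)).symm.trans ?_
  rw [inner_toLp_two]
  simp [sq]

theorem pderiv_eq_fderiv {d : ℕ} {g : (Fin d → ℝ) → ℝ} (hg : Differentiable ℝ g) (i : Fin d) :
    pderiv d i g = fun x => fderiv ℝ g x (Pi.single i 1) := by
  funext x
  have h := (hg (Function.update x i (x i))).hasFDerivAt.comp_hasDerivAt (x i)
    (hasDerivAt_update x i (x i))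
  rw [Function.update_eq_self] at h
  exact h.deriv

theorem contDiff_pderiv {d n : ℕ} {g : (Fin d → ℝ) → ℝ} (hg : ContDiff ℝ (n + 1 : ℕ) g)
    (i : Fin d) : ContDiff ℝ n (pderiv d i g) := by
  rw [pderiv_eq_fderiv (hg.differentiable (by simp)) i]
  exact (hg.fderiv_right (m := n) (by norm_cast)).clm_apply contDiff_const

theorem fderiv_phi_single (d : ℕ) (k : Fin d → ℤ) (x : Fin d → ℝ) (i : Fin d) :
    fderiv ℝ (phi d k) x (Pi.single i 1) = 2 * Real.pi * Complex.I * k i * phi d k x := by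
  have h1 : HasFDerivAt (fun y : Fin d → ℝ =>
      Complex.I * (2 * Real.pi) * ∑ j, (k j : ℂ) * (y j : ℂ))
      ((Complex.I * (2 * Real.pi)) • ∑ j, (k j : ℂ) •
        (Complex.ofRealCLM.comp (ContinuousLinearMap.proj (R := ℝ) j))) x :=
    (HasFDerivAt.fun_sum fun j _ =>
      (Complex.ofRealCLM.hasFDerivAt.comp x (hasFDerivAt_apply j x)).const_mul _).const_mul _
  have h2 : fderiv ℝ (phi d k) x = _ := (h1.cexp).fderiv
  rw [h2]
  simp [Pi.single_apply, phi, apply_ite]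
  ring

/-- The integral over the unit cube of a partial derivative of a `C¹` function which takes equal
values on the two corresponding opposite faces vanishes. -/
theorem integral_fderiv_single_eq_zero {n : ℕ} {G : (Fin (n + 1) → ℝ) → ℂ} (hG : ContDiff ℝ 1 G)
    (i : Fin (n + 1))
    (hper : ∀ x ∈ cube (n + 1), x i = 0 → G x = G (Function.update x i 1)) :
    ∫ x in cube (n + 1), fderiv ℝ G x (Pi.single i 1) = 0 := by
  have hdiff := hG.differentiable one_ne_zero
  have key := integral_divergence_of_hasFDerivAt_off_countable' (E := ℂ)
    (0 : Fin (n + 1) → ℝ) 1 zero_le_one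
    (fun j => if j = i then G else 0) (fun j x => if j = i then fderiv ℝ G x else 0) ∅
    Set.countable_empty
    (fun j => by
      split_ifs
      · exact hG.continuous.continuousOn
      · exact continuousOn_const)
    (fun x _ j => by
      split_ifs
      · exact (hdiff x).hasFDerivAt
      · exact hasFDerivAt_const 0 x)
    (by
      refine ContinuousOn.integrableOn_compact isCompact_Icc (Continuous.continuousOn ?_)
      refine continuous_finsetSum _ fun j _ => ?_
      split_ifs
      · exact (hG.continuous_fderiv one_ne_zero).clm_apply continuous_const
      · exact continuous_const)
  have hl : ∀ x : Fin (n + 1) → ℝ, ∑ j, (if j = i then fderiv ℝ G x else 0) (Pi.single j 1) =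
      fderiv ℝ G x (Pi.single i 1) := by
    intro x
    rw [Finset.sum_eq_single i]
    · simp
    · intro j _ hj
      simp [hj]
    · simp
  simp_rw [hl] at key
  refine key.trans (Finset.sum_eq_zero fun j _ => ?_)
  by_cases hj : j = i
  · subst hj
    rw [sub_eq_zero]
    refine setIntegral_congr_fun measurableSet_Icc fun y hy => ?_
    have hmem : j.insertNth (0 : ℝ) y ∈ cube (n + 1) := by
      refine ⟨fun l => ?_, fun l => ?_⟩ <;> refine Fin.succAboveCases j ?_ (fun m => ?_) l
      · simp
      · simpa using hy.1 m
      · simp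
      · simpa using hy.2 m
    have := hper _ hmem (by simp)
    rw [Fin.update_insertNth] at this
    simpa using this.symm
  · simp [hj]

theorem fCoeff_pderiv {d : ℕ} {h : (Fin d → ℝ) → ℝ} (hh : ContDiff ℝ 1 h) (i : Fin d)
    (hper : ∀ x ∈ cube d, x i = 0 → h x = h (Function.update x i 1)) (k : Fin d → ℤ) :
    fCoeff d (fun x => (pderiv d i h x : ℂ)) k =
      2 * Real.pi * Complex.I * k i * fCoeff d (fun x => (h x : ℂ)) k := by
  obtain _ | n := d
  · exact i.elim0
  have hofReal : ContDiff ℝ 1 fun x => (h x : ℂ) := Complex.ofRealCLM.contDiff.comp hh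
  have hperphi : ∀ x : Fin (n + 1) → ℝ, x i = 0 →
      phi (n + 1) (-k) x = phi (n + 1) (-k) (Function.update x i 1) := by
    intro x hx
    have hsum : ∑ j, ((-k) j : ℂ) * ((Function.update x i 1 j : ℝ) : ℂ) =
        ∑ j, ((-k) j : ℂ) * (x j : ℂ) + ((-k) i : ℂ) := by
      rw [← Finset.add_sum_erase _ _ (Finset.mem_univ i),
        ← Finset.add_sum_erase _ (fun j => ((-k) j : ℂ) * (x j : ℂ)) (Finset.mem_univ i)]
      rw [Finset.sum_congr rfl fun j hj => by
        rw [Function.update_of_ne (Finset.ne_of_mem_erase hj)]]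
      simp [hx]
      ring
    rw [phi, phi, hsum, mul_add, Complex.exp_add]
    have : Complex.exp (Complex.I * (2 * Real.pi) * (((-k) i : ℤ) : ℂ)) = 1 := by
      rw [← Complex.exp_int_mul_two_pi_mul_I ((-k) i)]
      congr 1
      ring
    rw [this, mul_one]
  have hzero := integral_fderiv_single_eq_zero (hofReal.mul (contDiff_phi (n + 1) (-k))) i
    (fun x hx hx0 => by
      simp only [hper x hx hx0, hperphi x hx0])
  have hderiv : ∀ x, fderiv ℝ (fun x => (h x : ℂ) * phi (n + 1) (-k) x) x (Pi.single i 1) =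
      (pderiv (n + 1) i h x : ℂ) * phi (n + 1) (-k) x -
        2 * Real.pi * Complex.I * k i * ((h x : ℂ) * phi (n + 1) (-k) x) := by
    intro x
    have h1 : HasFDerivAt (fun x => (h x : ℂ)) (Complex.ofRealCLM.comp (fderiv ℝ h x)) x :=
      Complex.ofRealCLM.hasFDerivAt.comp x (hh.differentiable one_ne_zero x).hasFDerivAt
    have h2 := ((contDiff_phi (n + 1) (-k) (n := 1)).differentiable one_ne_zero x).hasFDerivAt
    rw [(h1.fun_mul h2).fderiv, pderiv_eq_fderiv (hh.differentiable one_ne_zero)]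
    simp [fderiv_phi_single]
    ring
  have hcont : Continuous (pderiv (n + 1) i h) :=
    (contDiff_pderiv (n := 0) (by simpa using hh) i).continuous
  have hint : ∀ g : (Fin (n + 1) → ℝ) → ℝ, Continuous g →
      IntegrableOn (fun x => (g x : ℂ) * phi (n + 1) (-k) x) (cube (n + 1)) := fun g hg =>
    ((Complex.continuous_ofReal.comp hg).mul
      (continuous_phi _ _)).continuousOn.integrableOn_compact isCompact_Icc
  simp_rw [hderiv] at hzero
  rw [integral_sub (hint _ hcont) ((hint _ hh.continuous).const_mul _), integral_const_mul,
    sub_eq_zero] at hzero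
  simpa only [fCoeff, conj_phi] using hzero

theorem foldr_pderiv_congr {d : ℕ} {α γ : Fin d → ℕ} (g : (Fin d → ℝ) → ℝ) (l : List (Fin d))
    (h : ∀ i ∈ l, α i = γ i) :
    l.foldr (fun i h => (pderiv d i)^[α i] h) g = l.foldr (fun i h => (pderiv d i)^[γ i] h) g := by
  induction l with
  | nil => rfl
  | cons j t ih =>
    rw [List.foldr_cons, List.foldr_cons, ih fun i hi => h i (List.mem_cons_of_mem _ hi),
      h j List.mem_cons_self]

theorem exists_foldr_eq_pderiv {d : ℕ} (α : Fin d → ℕ) (g : (Fin d → ℝ) → ℝ) (l : List (Fin d))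
    (hl : l.Nodup) (h : ∃ i ∈ l, α i ≠ 0) :
    ∃ i ∈ l, α i ≠ 0 ∧ l.foldr (fun i h => (pderiv d i)^[α i] h) g =
      pderiv d i (l.foldr (fun j h => (pderiv d j)^[Function.update α i (α i - 1) j] h) g) := by
  induction l with
  | nil => simp at h
  | cons j t ih =>
    rw [List.nodup_cons] at hl
    by_cases hj : α j = 0
    · obtain ⟨i, hi, hi0⟩ := h
      obtain rfl | hit := List.mem_cons.mp hi
      · exact absurd hj hi0
      obtain ⟨m, hm, hm0, he⟩ := ih hl.2 ⟨i, hit, hi0⟩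
      have hjm : j ≠ m := fun h => hl.1 (h ▸ hm)
      refine ⟨m, List.mem_cons_of_mem _ hm, hm0, ?_⟩
      simp only [List.foldr_cons, he, Function.update_of_ne hjm, hj, Function.iterate_zero, id]
    · refine ⟨j, List.mem_cons_self, hj, ?_⟩
      obtain ⟨n, hn⟩ := Nat.exists_eq_succ_of_ne_zero hj
      rw [List.foldr_cons, List.foldr_cons, Function.update_self, ← Function.iterate_succ_apply' (pderiv d j),
        foldr_pderiv_congr (γ := Function.update α j (α j - 1)) g t fun i hi =>
          (Function.update_of_ne (ne_of_mem_of_not_mem hi hl.1) _ _).symm]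
      simp [hn]

theorem exists_mderiv_eq_pderiv {d : ℕ} (α : Fin d → ℕ) (g : (Fin d → ℝ) → ℝ)
    (h : ∃ i, α i ≠ 0) :
    ∃ i, α i ≠ 0 ∧ mderiv d α g = pderiv d i (mderiv d (Function.update α i (α i - 1)) g) := by
  obtain ⟨i, hi⟩ := h
  obtain ⟨m, -, hm⟩ := exists_foldr_eq_pderiv α g (List.finRange d) (List.nodup_finRange d)
    ⟨i, List.mem_finRange i, hi⟩
  exact ⟨m, hm⟩

theorem contDiff_mderiv_and_fCoeff_mderiv {d β : ℕ} {L : ℝ} {f : (Fin d → ℝ) → ℝ}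
    (hf : SobolevP d β L f) (k : Fin d → ℤ) (n m : ℕ) (hmn : n + m = β) (α : Fin d → ℕ)
    (hα : ∑ i, α i = m) :
    ContDiff ℝ n (mderiv d α f) ∧
      fCoeff d (fun x => (mderiv d α f x : ℂ)) k =
        (∏ i, (2 * Real.pi * Complex.I * k i) ^ α i) * fCoeff d (fun x => (f x : ℂ)) k := by
  induction m generalizing n α with
  | zero =>
    obtain rfl : α = 0 := funext fun i => (Finset.sum_eq_zero_iff.mp hα) i (Finset.mem_univ i)
    have h0 : mderiv d 0 f = f := by
      simp [mderiv]
    obtain rfl : n = β := hmn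
    rw [h0]
    exact ⟨hf.1, by simp⟩
  | succ m ih =>
    have hex : ∃ i, α i ≠ 0 := by
      by_contra! h
      simp [h] at hα
    obtain ⟨i, hi, he⟩ := exists_mderiv_eq_pderiv α f hex
    set γ := Function.update α i (α i - 1) with hγ
    have hαγ : ∀ j, α j = γ j + if j = i then 1 else 0 := by
      intro j
      by_cases hj : j = i
      · subst hj
        simp only [hγ, Function.update_self, if_true]
        omega
      · simp [hγ, hj]
    have hsum : ∑ j, γ j = m := by
      simp_rw [hαγ, Finset.sum_add_distrib] at hα
      simpa using hα
    obtain ⟨hcd, hfc⟩ := ih (n + 1) (by omega) γ hsum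
    rw [he]
    refine ⟨contDiff_pderiv hcd i, ?_⟩
    rw [fCoeff_pderiv (hcd.of_le (by norm_cast; omega)) i (fun x hx hx0 => by
      simpa [hx0] using hf.2.2 γ (by omega) x hx i (Or.inl hx0)), hfc, ← mul_assoc]
    congr 1
    simp_rw [hαγ, pow_add, Finset.prod_mul_distrib]
    rw [mul_comm]
    simp

/-- Fourier tails in the periodic Sobolev space. If
`f ∈ S_L^p(β)` with `β ≥ 1`, then
`Σ_{k ∈ ℤ^d} (Σ_{|α| = β} Π_i (2π k_i)^{2 α_i}) |θ_k(f)|² ≤ L²`. -/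
theorem stmt2 (d β : ℕ) (hd : 1 ≤ d) (hβ : 1 ≤ β) (L : ℝ) (hL : 0 < L)
    (f : (Fin d → ℝ) → ℝ) (hf : SobolevP d β L f) :
    ∑' k : Fin d → ℤ,
        (∑ α ∈ multiIdx d β, ∏ i, (2 * Real.pi * (k i : ℝ)) ^ (2 * α i)) *
          ‖fCoeff d (fun x => (f x : ℂ)) k‖ ^ 2 ≤ L ^ 2 := by
  refine Real.tsum_le_of_sum_le (fun k => ?_) fun s => ?_
  · refine mul_nonneg (Finset.sum_nonneg fun α _ => Finset.prod_nonneg fun i _ => ?_) (sq_nonneg _)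
    rw [pow_mul]
    positivity
  · have hterm : ∀ α ∈ multiIdx d β, ∑ k ∈ s, (∏ i, (2 * Real.pi * (k i : ℝ)) ^ (2 * α i)) *
        ‖fCoeff d (fun x => (f x : ℂ)) k‖ ^ 2 ≤ ∫ x in cube d, (mderiv d α f x) ^ 2 := by
      intro α hα
      have hsum : ∑ i, α i = β := (Finset.mem_filter.mp hα).2
      have hcd := fun k => contDiff_mderiv_and_fCoeff_mderiv hf k 0 β (zero_add β) α hsum
      refine le_trans (Finset.sum_le_sum fun k _ => ?_) (sum_sq_fCoeff_le (hcd 0).1.continuous s)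
      rw [(hcd k).2, norm_mul, mul_pow, norm_prod, ← Finset.prod_pow]
      refine le_of_eq (congrArg (· * _) (Finset.prod_congr rfl fun i _ => ?_))
      rw [norm_pow, ← pow_mul, mul_comm (α i) 2, pow_mul, pow_mul]
      simp [mul_pow]
    simp_rw [Finset.sum_mul]
    rw [Finset.sum_comm]
    exact (Finset.sum_le_sum hterm).trans hf.2.1

end
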